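/- Define ω_{n,j} = λ_{n,j} − Σ_{k=0}^{3} d_k(jπ/(n+2))/(n+2)^k. Then for each fixed integer j ≥ 1: lim_{n→∞} ω_{n,j}/λ_{n,j} = (α_j^4 + (π/2)^4 − (jπ + π/2)^4)/α_j^4 and lim_{n→∞} ω_{n,j}/(λ_{n,j+1} − λ_{n,j}) = (α_j^4 + (π/2)^4 − (jπ + π/2)^4)/(α_{j+1}^4 − α_j^4), and both limits are nonzero. -/

import Mathlib

open Real Set Filter Topology

/-- The symbol `g(x) = (2 sin(x/2))^4`. -/
noncomputable def g (x : ℝ) : ℝ := (2 * Real.sin (x / 2)) ^ 4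

/-- The `n × n` pentadiagonal Toeplitz matrix generated by `g`. -/
noncomputable def T (n : ℕ) : Matrix (Fin n) (Fin n) ℝ :=
  Matrix.of fun j k =>
    if ((j : ℤ) - (k : ℤ)) = 0 then 6
    else if ((j : ℤ) - (k : ℤ)) = 1 ∨ ((j : ℤ) - (k : ℤ)) = -1 then -4
    else if ((j : ℤ) - (k : ℤ)) = 2 ∨ ((j : ℤ) - (k : ℤ)) = -2 then 1
    else 0

/-- `f(x) = cos(x/2) / (1 + sin(x/2)^2)`. -/
noncomputable def fsym (x : ℝ) : ℝ := Real.cos (x / 2) / (1 + (Real.sin (x / 2)) ^ 2)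

/-- `η(x) = 2 arctan(1/f(x))` for `x ∈ [0,π)`, extended continuously by `η(π) = π`. -/
noncomputable def eta (x : ℝ) : ℝ :=
  if x < Real.pi then 2 * Real.arctan (1 / fsym x) else Real.pi

noncomputable def c1 : ℝ → ℝ := eta

noncomputable def c2 (x : ℝ) : ℝ := eta x * deriv eta x

noncomputable def c3 (x : ℝ) : ℝ :=
  eta x * (deriv eta x) ^ 2 + (1 / 2) * (eta x) ^ 2 * iteratedDeriv 2 eta x

noncomputable def d0 : ℝ → ℝ := g

noncomputable def d1 (x : ℝ) : ℝ := deriv g x * c1 x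

noncomputable def d2 (x : ℝ) : ℝ :=
  deriv g x * c2 x + (1 / 2) * iteratedDeriv 2 g x * (c1 x) ^ 2

noncomputable def d3 (x : ℝ) : ℝ :=
  deriv g x * c3 x + iteratedDeriv 2 g x * c1 x * c2 x
    + (1 / 6) * iteratedDeriv 3 g x * (c1 x) ^ 3

noncomputable def dcoef : ℕ → ℝ → ℝ
  | 0 => d0
  | 1 => d1
  | 2 => d2
  | 3 => d3
  | _ => fun _ => 0

theorem sum_ite_eq_of_boundary (n : ℕ) (w : ℤ → ℝ) (h₁ : w (-2) = 0) (h₂ : w (-1) = 0)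
    (h₃ : w n = 0) (h₄ : w (n + 1) = 0) (m : ℤ) (hm : -2 ≤ m) (hm' : m ≤ n + 1) :
    ∑ k : Fin n, (if (k : ℤ) = m then w k else 0) = w m := by
  by_cases h : 0 ≤ m ∧ m < n
  · lift m to ℕ using h.1
    have hmn : m < n := by exact_mod_cast h.2
    rw [Finset.sum_eq_single (⟨m, hmn⟩ : Fin n)]
    · simp
    · intro k _ hk
      rw [if_neg]
      intro h'
      exact hk (Fin.ext (by exact_mod_cast h'))
    · simp
  · rw [Finset.sum_eq_zero]
    · have : m = -2 ∨ m = -1 ∨ m = n ∨ m = n + 1 := by omega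
      rcases this with rfl | rfl | rfl | rfl <;> simp [*]
    · intro k _
      rw [if_neg]
      have := k.2
      omega

theorem T_mulVec_apply (n : ℕ) (w : ℤ → ℝ) (h₁ : w (-2) = 0) (h₂ : w (-1) = 0)
    (h₃ : w n = 0) (h₄ : w (n + 1) = 0) (i : Fin n) :
    (T n).mulVec (fun k : Fin n => w k) i
      = w (i - 2) - 4 * w (i - 1) + 6 * w i - 4 * w (i + 1) + w (i + 2) := by
  have hi := i.2
  have key := sum_ite_eq_of_boundary n w h₁ h₂ h₃ h₄
  rw [← key (i - 2) (by omega) (by omega), ← key (i - 1) (by omega) (by omega),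
    ← key i (by omega) (by omega), ← key (i + 1) (by omega) (by omega),
    ← key (i + 2) (by omega) (by omega)]
  simp only [Matrix.mulVec, dotProduct, Finset.mul_sum, ← Finset.sum_add_distrib,
    ← Finset.sum_sub_distrib]
  refine Finset.sum_congr rfl fun k _ => ?_
  simp only [T, Matrix.of_apply]
  split_ifs <;> first | omega | ring

theorem mem_spectrum_T_of_recurrence (n : ℕ) (μ : ℝ) (w : ℤ → ℝ) (h₁ : w (-2) = 0)
    (h₂ : w (-1) = 0) (h₃ : w n = 0) (h₄ : w (n + 1) = 0)
    (hrec : ∀ k, w (k - 2) - 4 * w (k - 1) + 6 * w k - 4 * w (k + 1) + w (k + 2) = μ * w k)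
    (hne : ∃ k : Fin n, w k ≠ 0) : μ ∈ spectrum ℝ (T n) := by
  rw [← Matrix.spectrum_toLin', ← Module.End.hasEigenvalue_iff_mem_spectrum]
  refine Module.End.hasEigenvalue_of_hasEigenvector (x := fun k : Fin n => w k) ⟨?_, ?_⟩
  · rw [Module.End.mem_eigenspace_iff]
    ext i
    rw [Matrix.toLin'_apply, T_mulVec_apply n w h₁ h₂ h₃ h₄, hrec]
    simp
  · intro h
    obtain ⟨k, hk⟩ := hne
    exact hk (congrFun h k)

/-- A combination of an oscillating solution `p` and a hyperbolic solution `q` of the eigenvalue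
recurrence that vanishes at the four boundary points gives an eigenvalue. -/
theorem sq_mem_spectrum_T (n : ℕ) (hn : 1 ≤ n) (μ c d : ℝ) (hμ : μ ≠ 0) (hc : c ≠ 0)
    (p q : ℤ → ℝ) (hp : ∀ k, p (k + 1) + p (k - 1) = (2 - μ) * p k)
    (hq : ∀ k, q (k + 1) + q (k - 1) = (2 + μ) * q k)
    (hp0 : ¬ (p (-1) = 0 ∧ p 0 = 0))
    (h₁ : c * p (-2) = d * q (-2)) (h₂ : c * p (-1) = d * q (-1))
    (h₃ : c * p n = d * q n) (h₄ : c * p (n + 1) = d * q (n + 1)) :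
    μ ^ 2 ∈ spectrum ℝ (T n) := by
  refine mem_spectrum_T_of_recurrence n (μ ^ 2) (fun k => c * p k - d * q k)
    (sub_eq_zero.2 h₁) (sub_eq_zero.2 h₂) (sub_eq_zero.2 h₃) (sub_eq_zero.2 h₄) ?_ ?_
  · intro k
    have e1 := hp (k - 1)
    have e2 := hp k
    have e3 := hp (k + 1)
    have f1 := hq (k - 1)
    have f2 := hq k
    have f3 := hq (k + 1)
    rw [show k - 1 + 1 = k by ring, show k - 1 - 1 = k - 2 by ring] at e1 f1
    rw [show k + 1 + 1 = k + 2 by ring, show k + 1 - 1 = k by ring] at e3 f3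
    linear_combination c * (e1 + e3 - (2 + μ) * e2) - d * (f1 + f3 - (2 - μ) * f2)
  · by_contra! hz
    have hv : ∀ k : ℤ, -2 ≤ k → k ≤ 1 → c * p k = d * q k := by
      intro k hk hk'
      by_cases hkn : 0 ≤ k ∧ k < n
      · lift k to ℕ using hkn.1
        exact sub_eq_zero.1 (hz ⟨k, by exact_mod_cast hkn.2⟩)
      · have : k = -2 ∨ k = -1 ∨ k = n := by omega
        rcases this with rfl | rfl | rfl <;> assumption
    have hk : ∀ k : ℤ, -2 ≤ k - 1 → k + 1 ≤ 1 → p k = 0 := by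
      intro k hk hk'
      have h : 2 * μ * c * p k = 0 := by
        linear_combination c * hp k - d * hq k - hv (k + 1) (by omega) hk'
          - hv (k - 1) hk (by omega) + (2 + μ) * hv k (by omega) (by omega)
      have : 2 * μ * c ≠ 0 := by positivity
      exact (mul_eq_zero.1 h).resolve_left this
    exact hp0 ⟨hk (-1) (by norm_num) (by norm_num), hk 0 (by norm_num) (by norm_num)⟩

/-- The positive number `b` with `sinh b = sin (φ / 2)`. -/
noncomputable def hypAngle (φ : ℝ) : ℝ := Real.arsinh (Real.sin (φ / 2))

theorem sinh_hypAngle (φ : ℝ) : Real.sinh (hypAngle φ) = Real.sin (φ / 2) :=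
  Real.sinh_arsinh _

/-- The characteristic function of the eigenvalues with symmetric eigenvectors. -/
noncomputable def symmChar (N φ : ℝ) : ℝ :=
  Real.cos (N * φ / 2) * Real.cos (φ / 2) * Real.sinh (N * hypAngle φ)
    + Real.sin (N * φ / 2) * Real.cosh (N * hypAngle φ) * Real.cosh (hypAngle φ)

/-- The characteristic function of the eigenvalues with skew-symmetric eigenvectors. -/
noncomputable def skewChar (N φ : ℝ) : ℝ :=
  Real.sin (N * φ / 2) * Real.cos (φ / 2) * Real.cosh (N * hypAngle φ)
    - Real.cos (N * φ / 2) * Real.sinh (N * hypAngle φ) * Real.cosh (hypAngle φ)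

theorem cos_eq_one_sub_half_sin_sq (φ : ℝ) : 2 * Real.cos φ = 2 - 4 * Real.sin (φ / 2) ^ 2 := by
  have h := Real.cos_two_mul (φ / 2)
  rw [mul_div_cancel₀ φ two_ne_zero] at h
  linarith [Real.sin_sq_add_cos_sq (φ / 2)]

theorem cosh_two_mul_hypAngle (φ : ℝ) :
    2 * Real.cosh (2 * hypAngle φ) = 2 + 4 * Real.sin (φ / 2) ^ 2 := by
  rw [Real.cosh_two_mul, ← sinh_hypAngle]
  linarith [Real.cosh_sq (hypAngle φ)]

theorem g_mem_spectrum_of_symmChar (n : ℕ) (hn : 1 ≤ n) (φ : ℝ) (hφ : φ ∈ Set.Ioo 0 Real.pi)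
    (h : symmChar (n + 2) φ = 0) : g φ ∈ spectrum ℝ (T n) := by
  have hs : 0 < Real.sin (φ / 2) :=
    Real.sin_pos_of_pos_of_lt_pi (by linarith [hφ.1]) (by linarith [hφ.1, hφ.2])
  have hsφ : 0 < Real.sin φ := Real.sin_pos_of_pos_of_lt_pi hφ.1 hφ.2
  have key : Real.cosh ((n + 3) * hypAngle φ) * Real.cos ((n + 1) * φ / 2)
      = Real.cos ((n + 3) * φ / 2) * Real.cosh ((n + 1) * hypAngle φ) := by
    have e1 : ((n : ℝ) + 3) * hypAngle φ = (n + 2) * hypAngle φ + hypAngle φ := by ring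
    have e2 : ((n : ℝ) + 1) * hypAngle φ = (n + 2) * hypAngle φ - hypAngle φ := by ring
    have e3 : ((n : ℝ) + 3) * φ / 2 = (n + 2) * φ / 2 + φ / 2 := by ring
    have e4 : ((n : ℝ) + 1) * φ / 2 = (n + 2) * φ / 2 - φ / 2 := by ring
    rw [e1, e2, e3, e4, Real.cosh_add, Real.cosh_sub, Real.cos_add, Real.cos_sub, sinh_hypAngle]
    unfold symmChar at h
    linear_combination 2 * Real.sin (φ / 2) * h
  rw [show g φ = (4 * Real.sin (φ / 2) ^ 2) ^ 2 by unfold g; ring]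
  refine sq_mem_spectrum_T n hn _ (Real.cosh ((n + 3) * hypAngle φ)) (Real.cos ((n + 3) * φ / 2))
    (by positivity) (Real.cosh_pos _).ne' (fun k => Real.cos (φ * (k - (n - 1) / 2)))
    (fun k => Real.cosh (2 * hypAngle φ * (k - (n - 1) / 2))) ?_ ?_ ?_ ?_ ?_ ?_ ?_
  · intro k
    rw [← cos_eq_one_sub_half_sin_sq]
    push_cast
    rw [show φ * ((k : ℝ) + 1 - (n - 1) / 2) = φ * (k - (n - 1) / 2) + φ by ring,
      show φ * ((k : ℝ) - 1 - (n - 1) / 2) = φ * (k - (n - 1) / 2) - φ by ring,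
      Real.cos_add, Real.cos_sub]
    ring
  · intro k
    rw [← cosh_two_mul_hypAngle]
    push_cast
    generalize 2 * hypAngle φ = ψ
    rw [show ψ * ((k : ℝ) + 1 - (n - 1) / 2) = ψ * (k - (n - 1) / 2) + ψ by ring,
      show ψ * ((k : ℝ) - 1 - (n - 1) / 2) = ψ * (k - (n - 1) / 2) - ψ by ring,
      Real.cosh_add, Real.cosh_sub]
    ring
  · rintro ⟨h1, h2⟩
    push_cast at h1 h2
    rw [show φ * ((0 : ℝ) - (n - 1) / 2) = φ * (-1 - (n - 1) / 2) + φ by ring,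
      Real.cos_add, h1, zero_mul, zero_sub, neg_eq_zero] at h2
    have := (mul_eq_zero.1 h2).resolve_right hsφ.ne'
    nlinarith [Real.sin_sq_add_cos_sq (φ * (-1 - ((n : ℝ) - 1) / 2))]
  · push_cast
    rw [← Real.cos_neg (φ * _), ← Real.cosh_neg (2 * hypAngle φ * _), mul_comm]
    congr 2 <;> ring
  · push_cast
    rw [← Real.cos_neg (φ * _), ← Real.cosh_neg (2 * hypAngle φ * _)]
    convert key using 3 <;> ring
  · push_cast
    convert key using 3 <;> ring
  · push_cast
    rw [mul_comm]
    congr 2 <;> ring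

theorem g_mem_spectrum_of_skewChar (n : ℕ) (hn : 1 ≤ n) (φ : ℝ) (hφ : φ ∈ Set.Ioo 0 Real.pi)
    (h : skewChar (n + 2) φ = 0) : g φ ∈ spectrum ℝ (T n) := by
  have hs : 0 < Real.sin (φ / 2) :=
    Real.sin_pos_of_pos_of_lt_pi (by linarith [hφ.1]) (by linarith [hφ.1, hφ.2])
  have hsφ : 0 < Real.sin φ := Real.sin_pos_of_pos_of_lt_pi hφ.1 hφ.2
  have hb : 0 < hypAngle φ := Real.arsinh_pos_iff.2 hs
  have key : Real.sinh ((n + 3) * hypAngle φ) * Real.sin ((n + 1) * φ / 2)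
      = Real.sin ((n + 3) * φ / 2) * Real.sinh ((n + 1) * hypAngle φ) := by
    have e1 : ((n : ℝ) + 3) * hypAngle φ = (n + 2) * hypAngle φ + hypAngle φ := by ring
    have e2 : ((n : ℝ) + 1) * hypAngle φ = (n + 2) * hypAngle φ - hypAngle φ := by ring
    have e3 : ((n : ℝ) + 3) * φ / 2 = (n + 2) * φ / 2 + φ / 2 := by ring
    have e4 : ((n : ℝ) + 1) * φ / 2 = (n + 2) * φ / 2 - φ / 2 := by ring
    rw [e1, e2, e3, e4, Real.sinh_add, Real.sinh_sub, Real.sin_add, Real.sin_sub, sinh_hypAngle]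
    unfold skewChar at h
    linear_combination 2 * Real.sin (φ / 2) * h
  rw [show g φ = (4 * Real.sin (φ / 2) ^ 2) ^ 2 by unfold g; ring]
  refine sq_mem_spectrum_T n hn _ (Real.sinh ((n + 3) * hypAngle φ)) (Real.sin ((n + 3) * φ / 2))
    (by positivity) (Real.sinh_pos_iff.2 (by positivity)).ne'
    (fun k => Real.sin (φ * (k - (n - 1) / 2)))
    (fun k => Real.sinh (2 * hypAngle φ * (k - (n - 1) / 2))) ?_ ?_ ?_ ?_ ?_ ?_ ?_
  · intro k
    rw [← cos_eq_one_sub_half_sin_sq]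
    push_cast
    rw [show φ * ((k : ℝ) + 1 - (n - 1) / 2) = φ * (k - (n - 1) / 2) + φ by ring,
      show φ * ((k : ℝ) - 1 - (n - 1) / 2) = φ * (k - (n - 1) / 2) - φ by ring,
      Real.sin_add, Real.sin_sub]
    ring
  · intro k
    rw [← cosh_two_mul_hypAngle]
    push_cast
    generalize 2 * hypAngle φ = ψ
    rw [show ψ * ((k : ℝ) + 1 - (n - 1) / 2) = ψ * (k - (n - 1) / 2) + ψ by ring,
      show ψ * ((k : ℝ) - 1 - (n - 1) / 2) = ψ * (k - (n - 1) / 2) - ψ by ring,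
      Real.sinh_add, Real.sinh_sub]
    ring
  · rintro ⟨h1, h2⟩
    push_cast at h1 h2
    rw [show φ * ((0 : ℝ) - (n - 1) / 2) = φ * (-1 - (n - 1) / 2) + φ by ring,
      Real.sin_add, h1, zero_mul, zero_add] at h2
    have := (mul_eq_zero.1 h2).resolve_right hsφ.ne'
    nlinarith [Real.sin_sq_add_cos_sq (φ * (-1 - ((n : ℝ) - 1) / 2))]
  · push_cast
    rw [show φ * ((-2 : ℝ) - (n - 1) / 2) = -((n + 3) * φ / 2) by ring,
      show 2 * hypAngle φ * ((-2 : ℝ) - (n - 1) / 2) = -((n + 3) * hypAngle φ) by ring,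
      Real.sin_neg, Real.sinh_neg]
    ring
  · push_cast
    rw [show φ * ((-1 : ℝ) - (n - 1) / 2) = -((n + 1) * φ / 2) by ring,
      show 2 * hypAngle φ * ((-1 : ℝ) - (n - 1) / 2) = -((n + 1) * hypAngle φ) by ring,
      Real.sin_neg, Real.sinh_neg]
    linear_combination -key
  · push_cast
    convert key using 3 <;> ring
  · push_cast
    rw [mul_comm]
    congr 2 <;> ring

/-- The equation satisfied by the `j`-th eigenvalue angle. -/
def AngleEq (N : ℝ) (j : ℕ) (φ : ℝ) : Prop :=
  (Odd j → symmChar N φ = 0) ∧ (Even j → skewChar N φ = 0)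

theorem continuous_hypAngle : Continuous hypAngle := by
  unfold hypAngle
  exact Real.continuous_arsinh.comp (by fun_prop)

theorem exists_mem_Ioo_eq_zero {F : ℝ → ℝ} (hF : Continuous F) {a b : ℝ} (hab : a ≤ b)
    (h : F a * F b < 0) : ∃ x ∈ Set.Ioo a b, F x = 0 := by
  rcases mul_neg_iff.1 h with ⟨ha, hb⟩ | ⟨ha, hb⟩
  · exact intermediate_value_Ioo' hab hF.continuousOn ⟨hb, ha⟩
  · exact intermediate_value_Ioo hab hF.continuousOn ⟨ha, hb⟩

theorem exists_angleEq (n j : ℕ) (hj : 1 ≤ j) (hjn : j ≤ n) :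
    ∃ φ ∈ Set.Ioo (j * Real.pi / ((n : ℝ) + 2)) ((j + 1) * Real.pi / ((n : ℝ) + 2)),
      AngleEq ((n : ℝ) + 2) j φ := by
  have hN : 0 < (n : ℝ) + 2 := by positivity
  have hj0 : 0 < (j : ℝ) := by exact_mod_cast hj
  have hjn' : (j : ℝ) ≤ n := by exact_mod_cast hjn
  have hpi := Real.pi_pos
  set l := j * Real.pi / ((n : ℝ) + 2) with hl
  set r := (j + 1) * Real.pi / ((n : ℝ) + 2) with hr
  have hl0 : 0 < l := by positivity
  have hlr : l < r := by rw [hl, hr]; gcongr; linarith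
  have hrpi : r < Real.pi := by
    rw [hr, div_lt_iff₀ hN]; nlinarith
  have hNl : ((n : ℝ) + 2) * l / 2 = j * Real.pi / 2 := by rw [hl]; field_simp
  have hNr : ((n : ℝ) + 2) * r / 2 = j * Real.pi / 2 + Real.pi / 2 := by rw [hr]; field_simp
  have hcos : ∀ x, 0 < x → x < Real.pi → 0 < Real.cos (x / 2) := fun x h h' =>
    Real.cos_pos_of_mem_Ioo ⟨by linarith, by linarith⟩
  have hb : ∀ x, 0 < x → x < Real.pi → 0 < hypAngle x := fun x h h' =>
    Real.arsinh_pos_iff.2 (Real.sin_pos_of_pos_of_lt_pi (by linarith) (by linarith))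
  have hsinh : ∀ x, 0 < x → x < Real.pi → 0 < Real.sinh (((n : ℝ) + 2) * hypAngle x) :=
    fun x h h' => Real.sinh_pos_iff.2 (mul_pos hN (hb x h h'))
  have h1 := hcos l hl0 (by linarith)
  have h2 := hcos r (by linarith) hrpi
  have h3 := hsinh l hl0 (by linarith)
  have h4 := hsinh r (by linarith) hrpi
  have h5 := fun x => Real.cosh_pos (((n : ℝ) + 2) * hypAngle x)
  have h6 := fun x => Real.cosh_pos (hypAngle x)
  have hcont := continuous_hypAngle
  have hsc := Real.sin_sq_add_cos_sq (j * Real.pi / 2)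
  have hprod := Real.sin_two_mul (j * Real.pi / 2)
  rw [show 2 * (j * Real.pi / 2) = j * Real.pi by ring, Real.sin_nat_mul_pi] at hprod
  rcases Nat.even_or_odd j with he | ho
  · have hs : Real.sin (j * Real.pi / 2) = 0 := by
      obtain ⟨m, rfl⟩ := he
      rw [← Real.sin_nat_mul_pi m]; congr 1; push_cast; ring
    have hc : Real.cos (j * Real.pi / 2) ^ 2 = 1 := by rw [hs] at hsc; linarith
    obtain ⟨φ, hφ, hφ'⟩ := exists_mem_Ioo_eq_zero (F := skewChar ((n : ℝ) + 2))
      (by unfold skewChar; fun_prop) hlr.le (by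
        unfold skewChar
        rw [hNl, hNr, Real.sin_add_pi_div_two, Real.cos_add_pi_div_two, hs]
        have := mul_pos (mul_pos h3 (h6 l)) (mul_pos h2 (h5 r))
        linear_combination this + (-(Real.sinh (((n : ℝ) + 2) * hypAngle l) *
          Real.cosh (hypAngle l) * (Real.cos (r / 2) * Real.cosh (((n : ℝ) + 2) * hypAngle r)))) * hc)
    exact ⟨φ, hφ, fun h => absurd he (Nat.not_even_iff_odd.2 h), fun _ => hφ'⟩
  · have hc : Real.cos (j * Real.pi / 2) = 0 := by
      obtain ⟨m, rfl⟩ := ho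
      rw [show ((2 * m + 1 : ℕ) : ℝ) * Real.pi / 2 = m * Real.pi + Real.pi / 2 by push_cast; ring,
        Real.cos_add_pi_div_two, Real.sin_nat_mul_pi, neg_zero]
    have hs : Real.sin (j * Real.pi / 2) ^ 2 = 1 := by rw [hc] at hsc; linarith
    obtain ⟨φ, hφ, hφ'⟩ := exists_mem_Ioo_eq_zero (F := symmChar ((n : ℝ) + 2))
      (by unfold symmChar; fun_prop) hlr.le (by
        unfold symmChar
        rw [hNl, hNr, Real.sin_add_pi_div_two, Real.cos_add_pi_div_two, hc]
        have := mul_pos (mul_pos (h5 l) (h6 l)) (mul_pos h2 h4)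
        linear_combination this + (-(Real.cosh (((n : ℝ) + 2) * hypAngle l) *
          Real.cosh (hypAngle l) * (Real.cos (r / 2) * Real.sinh (((n : ℝ) + 2) * hypAngle r)))) * hs)
    exact ⟨φ, hφ, fun _ => hφ', fun h => absurd h (Nat.not_even_iff_odd.2 ho)⟩

theorem g_strictMonoOn : StrictMonoOn g (Set.Icc 0 Real.pi) := by
  intro x hx y hy hxy
  have h0 : 0 ≤ Real.sin (x / 2) :=
    Real.sin_nonneg_of_nonneg_of_le_pi (by linarith [hx.1]) (by linarith [hx.1, hx.2])
  have h : Real.sin (x / 2) < Real.sin (y / 2) :=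
    Real.sin_lt_sin_of_lt_of_le_pi_div_two (by linarith [hx.1, Real.pi_pos])
      (by linarith [hy.2]) (by linarith)
  unfold g
  gcongr

theorem eq_of_strictMono_of_spectrum (n : ℕ) (a b : Fin n → ℝ) (ha : StrictMono a)
    (hb : StrictMono b) (ha' : ∀ i, a i ∈ spectrum ℝ (T n)) (hb' : ∀ i, b i ∈ spectrum ℝ (T n)) :
    a = b := by
  classical
  set s := (T n).charpoly.roots.toFinset with hs
  have hmem : ∀ x, x ∈ spectrum ℝ (T n) → x ∈ s := fun x hx => by
    rw [hs, Multiset.mem_toFinset, Polynomial.mem_roots (Matrix.charpoly_monic _).ne_zero]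
    exact Matrix.mem_spectrum_iff_isRoot_charpoly.1 hx
  have hcard : s.card = n := by
    apply le_antisymm
    · refine (Multiset.toFinset_card_le _).trans ((Polynomial.card_roots' _).trans ?_)
      rw [Matrix.charpoly_natDegree_eq_dim, Fintype.card_fin]
    · have := Finset.card_le_card_of_injOn (s := Finset.univ) a
        (fun i _ => hmem _ (ha' i)) ha.injective.injOn
      simpa using this
  rw [Finset.orderEmbOfFin_unique hcard (fun i => hmem _ (ha' i)) ha,
    Finset.orderEmbOfFin_unique hcard (fun i => hmem _ (hb' i)) hb]

theorem exists_angle_of_eigenvalue (lam : ℕ → ℕ → ℝ)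
    (hmono : ∀ n, 1 ≤ n → ∀ j k, 1 ≤ j → j < k → k ≤ n → lam n j < lam n k)
    (hspec : ∀ n, 1 ≤ n → ∀ j, 1 ≤ j → j ≤ n → lam n j ∈ spectrum ℝ (T n))
    (n j : ℕ) (hj : 1 ≤ j) (hjn : j ≤ n) :
    ∃ φ ∈ Set.Ioo (j * Real.pi / ((n : ℝ) + 2)) ((j + 1) * Real.pi / ((n : ℝ) + 2)),
      AngleEq ((n : ℝ) + 2) j φ ∧ lam n j = g φ := by
  have hn : 1 ≤ n := hj.trans hjn
  have hN : 0 < (n : ℝ) + 2 := by positivity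
  have hpi := Real.pi_pos
  choose φ hφ hφ' using fun i : Fin n => exists_angleEq n (i + 1) (by omega) (by omega)
  have hφpi : ∀ i, φ i ∈ Set.Ioo 0 Real.pi := fun i => by
    refine ⟨lt_of_le_of_lt (by positivity) (hφ i).1, (hφ i).2.trans_le ?_⟩
    rw [div_le_iff₀ hN, mul_comm]
    have : ((i + 1 : ℕ) : ℝ) ≤ n := by exact_mod_cast i.2
    gcongr
    linarith
  have hφmono : StrictMono φ := fun i k hik => by
    refine (hφ i).2.trans_le (le_trans ?_ (hφ k).1.le)
    have : ((i + 1 : ℕ) : ℝ) + 1 ≤ ((k + 1 : ℕ) : ℝ) := by exact_mod_cast Nat.succ_le_succ hik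
    gcongr
  have := eq_of_strictMono_of_spectrum n (fun i => lam n (i + 1)) (fun i => g (φ i))
    (fun i k hik => hmono n hn _ _ (by omega) (by simpa using hik) (by omega))
    (fun i k hik => g_strictMonoOn (Set.Ioo_subset_Icc_self (hφpi i))
      (Set.Ioo_subset_Icc_self (hφpi k)) (hφmono hik))
    (fun i => hspec n hn _ (by omega) (by omega))
    (fun i => by
      rcases Nat.even_or_odd (i + 1 : ℕ) with h | h
      · exact g_mem_spectrum_of_skewChar n hn _ (hφpi i) ((hφ' i).2 h)
      · exact g_mem_spectrum_of_symmChar n hn _ (hφpi i) ((hφ' i).1 h))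
  obtain ⟨m, rfl⟩ : ∃ m, j = m + 1 := ⟨j - 1, by omega⟩
  exact ⟨φ ⟨m, hjn⟩, hφ ⟨m, hjn⟩, hφ' ⟨m, hjn⟩, congrFun this ⟨m, hjn⟩⟩

theorem sin_ne_zero_of_mem_Ioo {j : ℕ} {x : ℝ}
    (hx : x ∈ Set.Ioo ((j : ℝ) * Real.pi) (((j : ℝ) + 1) * Real.pi)) : Real.sin x ≠ 0 := by
  intro h
  obtain ⟨k, rfl⟩ := Real.sin_eq_zero_iff.1 h
  have h1 : (j : ℝ) < k := lt_of_mul_lt_mul_right hx.1 Real.pi_pos.le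
  have h2 : (k : ℝ) < j + 1 := lt_of_mul_lt_mul_right hx.2 Real.pi_pos.le
  have h1' : (j : ℤ) < k := by exact_mod_cast h1
  have h2' : k < (j : ℤ) + 1 := by exact_mod_cast h2
  omega

theorem half_ne_zero_of_mem_Ioo {j : ℕ} {x : ℝ}
    (hx : x ∈ Set.Ioo ((j : ℝ) * Real.pi) (((j : ℝ) + 1) * Real.pi)) :
    Real.sin (x / 2) ≠ 0 ∧ Real.cos (x / 2) ≠ 0 := by
  have h := sin_ne_zero_of_mem_Ioo hx
  rw [show x = 2 * (x / 2) by ring, Real.sin_two_mul] at h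
  exact ⟨right_ne_zero_of_mul (left_ne_zero_of_mul h), right_ne_zero_of_mul h⟩

theorem eq_of_zeros {F F' : ℝ → ℝ} {a b x y : ℝ} (hF : ∀ t, HasDerivAt F (F' t) t)
    (hF' : ∀ t ∈ Set.Ioo a b, F' t ≠ 0) (hx : x ∈ Set.Icc a b) (hy : y ∈ Set.Icc a b)
    (hFx : F x = 0) (hFy : F y = 0) : x = y := by
  wlog hxy : x < y generalizing x y
  · rcases (not_lt.1 hxy).eq_or_lt with h | h
    · exact h.symm
    · exact (this hy hx hFy hFx h).symm
  obtain ⟨c, hc, hc'⟩ := exists_hasDerivAt_eq_zero hxy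
    (fun t _ => (hF t).continuousAt.continuousWithinAt) (hFx.trans hFy.symm) (fun t _ => hF t)
  exact absurd hc' (hF' c ⟨hx.1.trans_lt hc.1, hc.2.trans_le hy.2⟩)

/-- The limiting characteristic equation. -/
def LimitEq (j : ℕ) (x : ℝ) : Prop :=
  (Odd j → Real.cos (x / 2) * Real.sinh (x / 2) + Real.sin (x / 2) * Real.cosh (x / 2) = 0) ∧
  (Even j → Real.sin (x / 2) * Real.cosh (x / 2) - Real.cos (x / 2) * Real.sinh (x / 2) = 0)

theorem LimitEq.eq {j : ℕ} (hj : 1 ≤ j) {x y : ℝ}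
    (hx : x ∈ Set.Icc ((j : ℝ) * Real.pi) (((j : ℝ) + 1) * Real.pi))
    (hy : y ∈ Set.Icc ((j : ℝ) * Real.pi) (((j : ℝ) + 1) * Real.pi))
    (hxe : LimitEq j x) (hye : LimitEq j y) : x = y := by
  have hd : ∀ t : ℝ, HasDerivAt (fun t : ℝ => t / 2) (1 / 2) t := fun t =>
    (hasDerivAt_id t).div_const 2
  rcases Nat.even_or_odd j with h | h
  · refine eq_of_zeros
      (F := fun t => Real.sin (t / 2) * Real.cosh (t / 2) - Real.cos (t / 2) * Real.sinh (t / 2))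
      (F' := fun t => Real.sin (t / 2) * Real.sinh (t / 2)) (fun t => ?_) ?_ hx hy
      (hxe.2 h) (hye.2 h)
    · refine (((hd t).sin.mul (hd t).cosh).sub ((hd t).cos.mul (hd t).sinh)).congr_deriv ?_
      ring
    · intro t ht
      have h0 : 0 < t := lt_of_le_of_lt (by positivity) ht.1
      exact mul_ne_zero (half_ne_zero_of_mem_Ioo ht).1 (Real.sinh_pos_iff.2 (by linarith)).ne'
  · refine eq_of_zeros
      (F := fun t => Real.cos (t / 2) * Real.sinh (t / 2) + Real.sin (t / 2) * Real.cosh (t / 2))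
      (F' := fun t => Real.cos (t / 2) * Real.cosh (t / 2)) (fun t => ?_) ?_ hx hy
      (hxe.1 h) (hye.1 h)
    · refine (((hd t).cos.mul (hd t).sinh).add ((hd t).sin.mul (hd t).cosh)).congr_deriv ?_
      ring
    · intro t ht
      exact mul_ne_zero (half_ne_zero_of_mem_Ioo ht).2 (Real.cosh_pos _).ne'

theorem limitEq_of_tanh_eq {j : ℕ} {x : ℝ}
    (hx : x ∈ Set.Ioo ((j : ℝ) * Real.pi) (((j : ℝ) + 1) * Real.pi))
    (h : Real.tanh (x / 2) = (-1 : ℝ) ^ j * Real.tan (x / 2)) : LimitEq j x := by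
  have hc := (half_ne_zero_of_mem_Ioo hx).2
  have hch := (Real.cosh_pos (x / 2)).ne'
  rw [Real.tanh_eq_sinh_div_cosh, Real.tan_eq_sin_div_cos] at h
  refine ⟨fun ho => ?_, fun he => ?_⟩
  · rw [ho.neg_one_pow] at h
    field_simp at h
    linarith
  · rw [he.neg_one_pow] at h
    field_simp at h
    linarith

theorem hasDerivAt_hypAngle_zero : HasDerivAt hypAngle (1 / 2) 0 := by
  have h1 : HasDerivAt (fun t : ℝ => Real.sin (t / 2)) (1 / 2) 0 := by
    refine ((hasDerivAt_id (0 : ℝ)).div_const 2).sin.congr_deriv ?_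
    simp
  refine h1.arsinh.congr_deriv ?_
  simp

/-- Along any filter on which `N φ → x` and `N → ∞`, the angle equation becomes the limiting one. -/
theorem limitEq_of_tendsto {ι : Type*} {l : Filter ι} [l.NeBot] {N φ : ι → ℝ} {j : ℕ} {x : ℝ}
    (hN : Tendsto N l atTop) (hφ : ∀ᶠ i in l, 0 < φ i)
    (hx : Tendsto (fun i => N i * φ i) l (𝓝 x)) (h : ∀ᶠ i in l, AngleEq (N i) j (φ i)) :
    LimitEq j x := by
  have hφ0 : Tendsto φ l (𝓝 0) := by
    refine (hx.div_atTop hN).congr' ?_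
    filter_upwards [hN.eventually_gt_atTop 0] with i hi
    field_simp
  have hφ1 : Tendsto φ l (𝓝[≠] 0) :=
    tendsto_nhdsWithin_iff.2 ⟨hφ0, hφ.mono fun i hi => hi.ne'⟩
  have hB : Tendsto (fun i => N i * hypAngle (φ i)) l (𝓝 (x / 2)) := by
    have := hx.mul ((hasDerivAt_iff_tendsto_slope.1 hasDerivAt_hypAngle_zero).comp hφ1)
    rw [show x * (1 / 2) = x / 2 by ring] at this
    refine this.congr' ?_
    filter_upwards [hφ] with i hi
    simp only [Function.comp_apply, slope_def_field, hypAngle]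
    simp
    field_simp
  have hA : Tendsto (fun i => N i * φ i / 2) l (𝓝 (x / 2)) := hx.div_const 2
  have ha : Tendsto (fun i => Real.cos (φ i / 2)) l (𝓝 1) := by
    have := (Real.continuous_cos.tendsto _).comp (hφ0.div_const 2)
    simpa [Function.comp_def] using this
  have hb : Tendsto (fun i => Real.cosh (hypAngle (φ i))) l (𝓝 1) := by
    have := (Real.continuous_cosh.tendsto _).comp ((continuous_hypAngle.tendsto _).comp hφ0)
    have h0 : hypAngle 0 = 0 := by simp [hypAngle]
    rwa [h0, Real.cosh_zero] at this
  have hs := (Real.continuous_sin.tendsto _).comp hA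
  have hc := (Real.continuous_cos.tendsto _).comp hA
  have hsh := (Real.continuous_sinh.tendsto _).comp hB
  have hch := (Real.continuous_cosh.tendsto _).comp hB
  refine ⟨fun ho => ?_, fun he => ?_⟩
  · have h1 := ((hc.mul ha).mul hsh).add ((hs.mul hch).mul hb)
    have h2 : Tendsto (fun i => symmChar (N i) (φ i)) l (𝓝 0) :=
      tendsto_const_nhds.congr' (h.mono fun i hi => (hi.1 ho).symm)
    have := tendsto_nhds_unique h1 h2
    linarith
  · have h1 := ((hs.mul ha).mul hch).sub ((hc.mul hsh).mul hb)
    have h2 : Tendsto (fun i => skewChar (N i) (φ i)) l (𝓝 0) :=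
      tendsto_const_nhds.congr' (h.mono fun i hi => (hi.2 he).symm)
    have := tendsto_nhds_unique h1 h2
    linarith

theorem tendsto_natCast_add_two : Tendsto (fun n : ℕ => (n : ℝ) + 2) atTop atTop :=
  tendsto_atTop_add_const_right _ _ tendsto_natCast_atTop_atTop

theorem tendsto_angle {j : ℕ} (hj : 1 ≤ j) {a : ℝ}
    (ha : a ∈ Set.Ioo ((j : ℝ) * Real.pi) (((j : ℝ) + 1) * Real.pi))
    (hae : Real.tanh (a / 2) = (-1 : ℝ) ^ j * Real.tan (a / 2)) {φ : ℕ → ℝ}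
    (hφ : ∀ n, j ≤ n → φ n ∈
      Set.Ioo (j * Real.pi / ((n : ℝ) + 2)) ((j + 1) * Real.pi / ((n : ℝ) + 2)))
    (hφe : ∀ n, j ≤ n → AngleEq ((n : ℝ) + 2) j (φ n)) :
    Tendsto (fun n : ℕ => ((n : ℝ) + 2) * φ n) atTop (𝓝 a) := by
  refine (isCompact_Icc (a := (j : ℝ) * Real.pi)
    (b := ((j : ℝ) + 1) * Real.pi)).tendsto_nhds_of_unique_mapClusterPt ?_ ?_
  · filter_upwards [eventually_ge_atTop j] with n hn
    have hN : 0 < (n : ℝ) + 2 := by positivity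
    obtain ⟨h1, h2⟩ := hφ n hn
    rw [div_lt_iff₀ hN] at h1
    rw [lt_div_iff₀ hN] at h2
    constructor <;> linarith
  · intro y hy hcl
    obtain ⟨U, hU, hUy⟩ := mapClusterPt_iff_ultrafilter.1 hcl
    refine LimitEq.eq hj hy (Set.Ioo_subset_Icc_self ha) ?_ (limitEq_of_tanh_eq ha hae)
    refine limitEq_of_tendsto (l := (U : Filter ℕ)) (tendsto_natCast_add_two.mono_left hU) ?_ hUy ?_
    · refine hU ?_
      filter_upwards [eventually_ge_atTop j] with n hn
      exact lt_of_le_of_lt (by have := Real.pi_pos; positivity) (hφ n hn).1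
    · exact hU ((eventually_ge_atTop j).mono hφe)

theorem tendsto_mul_two_sin_half {ι : Type*} {l : Filter ι} {N φ : ι → ℝ} {x : ℝ}
    (hN : Tendsto N l atTop) (hφ : ∀ᶠ i in l, 0 < φ i)
    (hx : Tendsto (fun i => N i * φ i) l (𝓝 x)) :
    Tendsto (fun i => N i * (2 * Real.sin (φ i / 2))) l (𝓝 x) := by
  have hφ0 : Tendsto φ l (𝓝 0) := by
    refine (hx.div_atTop hN).congr' ?_
    filter_upwards [hN.eventually_gt_atTop 0] with i hi
    field_simp
  have hφ1 : Tendsto φ l (𝓝[≠] 0) :=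
    tendsto_nhdsWithin_iff.2 ⟨hφ0, hφ.mono fun i hi => hi.ne'⟩
  have h1 : HasDerivAt (fun t : ℝ => 2 * Real.sin (t / 2)) 1 0 := by
    refine (((hasDerivAt_id (0 : ℝ)).div_const 2).sin.const_mul 2).congr_deriv ?_
    simp
  have := hx.mul ((hasDerivAt_iff_tendsto_slope.1 h1).comp hφ1)
  rw [mul_one] at this
  refine this.congr' ?_
  filter_upwards [hφ] with i hi
  simp only [Function.comp_apply, slope_def_field]
  simp
  field_simp

theorem tendsto_eigenvalue (lam : ℕ → ℕ → ℝ)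
    (hmono : ∀ n, 1 ≤ n → ∀ j k, 1 ≤ j → j < k → k ≤ n → lam n j < lam n k)
    (hspec : ∀ n, 1 ≤ n → ∀ j, 1 ≤ j → j ≤ n → lam n j ∈ spectrum ℝ (T n))
    {j : ℕ} (hj : 1 ≤ j) {a : ℝ}
    (ha : a ∈ Set.Ioo ((j : ℝ) * Real.pi) (((j : ℝ) + 1) * Real.pi))
    (hae : Real.tanh (a / 2) = (-1 : ℝ) ^ j * Real.tan (a / 2)) :
    Tendsto (fun n : ℕ => ((n : ℝ) + 2) ^ 4 * lam n j) atTop (𝓝 (a ^ 4)) := by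
  choose! φ hφ hφe hlam using fun n (h : j ≤ n) =>
    exists_angle_of_eigenvalue lam hmono hspec n j hj h
  have h := tendsto_mul_two_sin_half tendsto_natCast_add_two (by
    filter_upwards [eventually_ge_atTop j] with n hn
    exact lt_of_le_of_lt (by have := Real.pi_pos; positivity) (hφ n hn).1)
    (tendsto_angle hj ha hae hφ hφe)
  refine (h.pow 4).congr' ?_
  filter_upwards [eventually_ge_atTop j] with n hn
  rw [hlam n hn, g]
  ring

theorem hasDerivAt_sin_half (x : ℝ) :
    HasDerivAt (fun t : ℝ => Real.sin (t / 2)) (Real.cos (x / 2) / 2) x :=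
  ((hasDerivAt_id x).div_const 2).sin.congr_deriv (by simp; ring)

theorem hasDerivAt_cos_half (x : ℝ) :
    HasDerivAt (fun t : ℝ => Real.cos (t / 2)) (-Real.sin (x / 2) / 2) x :=
  ((hasDerivAt_id x).div_const 2).cos.congr_deriv (by simp; ring)

theorem deriv_g : deriv g = fun x => 4 * (2 * Real.sin (x / 2)) ^ 3 * Real.cos (x / 2) := by
  funext x
  refine (HasDerivAt.congr_deriv (f := g)
    (((hasDerivAt_sin_half x).const_mul 2).pow 4) ?_).deriv
  push_cast
  ring

theorem iteratedDeriv_two_g : iteratedDeriv 2 g = fun x =>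
    12 * (2 * Real.sin (x / 2)) ^ 2 * Real.cos (x / 2) ^ 2 - (2 * Real.sin (x / 2)) ^ 4 := by
  rw [iteratedDeriv_succ, iteratedDeriv_one, deriv_g]
  funext x
  refine (HasDerivAt.congr_deriv
    (((((hasDerivAt_sin_half x).const_mul 2).pow 3).const_mul 4).mul
      (hasDerivAt_cos_half x)) ?_).deriv
  simp only [Pi.pow_apply]
  push_cast
  ring

theorem iteratedDeriv_three_g : iteratedDeriv 3 g = fun x =>
    24 * (2 * Real.sin (x / 2)) * Real.cos (x / 2) ^ 3
      - 10 * (2 * Real.sin (x / 2)) ^ 3 * Real.cos (x / 2) := by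
  rw [iteratedDeriv_succ, iteratedDeriv_two_g]
  funext x
  refine (HasDerivAt.congr_deriv
    ((((((hasDerivAt_sin_half x).const_mul 2).pow 2).const_mul 12).mul
      ((hasDerivAt_cos_half x).pow 2)).sub (((hasDerivAt_sin_half x).const_mul 2).pow 4)) ?_).deriv
  simp only [Pi.pow_apply]
  push_cast
  ring

theorem contDiffAt_eta_zero : ContDiffAt ℝ 2 eta 0 := by
  have hf : ContDiffAt ℝ 2 fsym 0 := by
    unfold fsym
    refine ContDiffAt.div (by fun_prop) (by fun_prop) (by simp)
  have h : ContDiffAt ℝ 2 (fun x => 2 * Real.arctan (1 / fsym x)) 0 :=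
    contDiffAt_const.mul ((contDiffAt_const.div hf (by simp [fsym])).arctan)
  refine h.congr_of_eventuallyEq ?_
  filter_upwards [eventually_lt_nhds Real.pi_pos] with x hx
  simp [eta, hx]

theorem eta_zero : eta 0 = Real.pi / 2 := by
  simp [eta, fsym, Real.pi_pos]
  ring

theorem tendsto_expansion (j : ℕ) (hj : 1 ≤ j) :
    Tendsto (fun n : ℕ => ((n : ℝ) + 2) ^ 4 * ∑ k ∈ Finset.range 4,
      dcoef k ((j : ℝ) * Real.pi / ((n : ℝ) + 2)) / ((n : ℝ) + 2) ^ k) atTop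
      (𝓝 (((j : ℝ) * Real.pi + Real.pi / 2) ^ 4 - (Real.pi / 2) ^ 4)) := by
  have hj0 : 0 < (j : ℝ) := by exact_mod_cast hj
  have hi : Tendsto (fun n : ℕ => ((n : ℝ) + 2)⁻¹) atTop (𝓝 0) :=
    tendsto_inv_atTop_zero.comp tendsto_natCast_add_two
  have hu : Tendsto (fun n : ℕ => (j : ℝ) * Real.pi / ((n : ℝ) + 2)) atTop (𝓝 0) :=
    tendsto_const_nhds.div_atTop tendsto_natCast_add_two
  have hS : Tendsto (fun n : ℕ => ((n : ℝ) + 2) *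
      (2 * Real.sin ((j : ℝ) * Real.pi / ((n : ℝ) + 2) / 2))) atTop (𝓝 (j * Real.pi)) := by
    refine tendsto_mul_two_sin_half tendsto_natCast_add_two
      (Eventually.of_forall fun n => by have := Real.pi_pos; positivity) ?_
    refine tendsto_const_nhds.congr fun n => ?_
    have : (n : ℝ) + 2 ≠ 0 := by positivity
    field_simp
  have hc : Tendsto (fun n : ℕ => Real.cos ((j : ℝ) * Real.pi / ((n : ℝ) + 2) / 2)) atTop
      (𝓝 1) := by
    have := (Real.continuous_cos.tendsto _).comp (hu.div_const 2)
    rwa [zero_div, Real.cos_zero] at this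
  have hcd := contDiffAt_eta_zero
  have he := hcd.continuousAt.tendsto.comp hu
  have hd1 : ContDiffAt ℝ 1 (deriv eta) 0 := hcd.derivWithin (by norm_num)
  have he1 := hd1.continuousAt.tendsto.comp hu
  have hd2 : ContDiffAt ℝ 0 (iteratedDeriv 2 eta) 0 := by
    rw [iteratedDeriv_succ, iteratedDeriv_one]
    exact hd1.derivWithin (by norm_num)
  have he2 := hd2.continuousAt.tendsto.comp hu
  rw [eta_zero] at he
  have hP1 := ((hS.pow 3).const_mul 4).mul hc
  have hP2 := (((hS.pow 2).const_mul 12).mul (hc.pow 2)).sub ((hS.pow 4).mul (hi.pow 2))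
  have hP3 := ((hS.const_mul 24).mul (hc.pow 3)).sub
    ((((hS.pow 3).const_mul 10).mul hc).mul (hi.pow 2))
  have key := (hS.pow 4).add ((hP1.mul he).add
    ((((hP1.mul hi).mul (he.mul he1)).add ((hP2.const_mul (1 / 2)).mul (he.pow 2))).add
      ((((hP1.mul (hi.pow 2)).mul ((he.mul (he1.pow 2)).add
        (((he.pow 2).const_mul (1 / 2)).mul he2))).add
        (((hP2.mul hi).mul he).mul (he.mul he1))).add ((hP3.const_mul (1 / 6)).mul (he.pow 3)))))
  convert key.congr ?_ using 2
  · ring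
  · intro n
    have hN : (n : ℝ) + 2 ≠ 0 := by positivity
    simp only [Finset.sum_range_succ, Finset.sum_range_zero, dcoef, d0, d1, d2, d3, c1, c2, c3,
      deriv_g, iteratedDeriv_two_g, iteratedDeriv_three_g, g, Function.comp_apply]
    generalize eta _ = e
    generalize deriv eta _ = e'
    generalize iteratedDeriv 2 eta _ = e''
    generalize Real.sin _ = s
    generalize Real.cos _ = c
    field_simp
    ring

theorem exp_bound {x : ℝ} (hx : 7 ≤ x) : 2.1 * (x + 0.1) ^ 3 < Real.exp x := by
  have h7 : (2.7 : ℝ) ^ 7 ≤ Real.exp 7 := by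
    rw [show (7 : ℝ) = ((7 : ℕ) : ℝ) * 1 by norm_num, Real.exp_nat_mul]
    have := Real.exp_one_gt_d9
    gcongr
    linarith
  have h : (1 + (x - 7) / 3) ^ 3 ≤ Real.exp (x - 7) := by
    rw [show x - 7 = ((3 : ℕ) : ℝ) * ((x - 7) / 3) by push_cast; ring, Real.exp_nat_mul]
    refine pow_le_pow_left₀ (by push_cast; linarith) ?_ 3
    have := Real.add_one_le_exp ((x - 7) / 3)
    push_cast
    linarith
  have hlin : (x + 0.1) ^ 3 ≤ (7.1 * (1 + (x - 7) / 3)) ^ 3 :=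
    pow_le_pow_left₀ (by linarith) (by linarith) 3
  have hpos : 0 < (1 + (x - 7) / 3) ^ 3 := by
    have : 0 < 1 + (x - 7) / 3 := by linarith
    positivity
  calc 2.1 * (x + 0.1) ^ 3 ≤ 2.1 * 7.1 ^ 3 * (1 + (x - 7) / 3) ^ 3 := by
        rw [mul_pow] at hlin; linarith
    _ < 2.7 ^ 7 * (1 + (x - 7) / 3) ^ 3 := by gcongr; norm_num
    _ ≤ Real.exp 7 * Real.exp (x - 7) := by gcongr
    _ = Real.exp x := by rw [← Real.exp_add]; congr 1; ring

theorem LimitEq.cos_mul_cosh {j : ℕ} {x : ℝ} (h : LimitEq j x) :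
    Real.cos x * Real.cosh x = 1 := by
  have hsq : Real.sin (x / 2) ^ 2 * Real.cosh (x / 2) ^ 2
      = Real.cos (x / 2) ^ 2 * Real.sinh (x / 2) ^ 2 := by
    rcases Nat.even_or_odd j with he | ho
    · have := h.2 he
      rw [← mul_pow, ← mul_pow, sub_eq_zero.1 this]
    · have := h.1 ho
      rw [← mul_pow, ← mul_pow, eq_neg_of_add_eq_zero_right this, neg_sq]
  have h1 := Real.cos_sq_add_sin_sq (x / 2)
  have h2 := Real.cosh_sq (x / 2)
  have hc := Real.cos_two_mul (x / 2)
  have hch := Real.cosh_two_mul (x / 2)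
  rw [mul_div_cancel₀ x two_ne_zero] at hc hch
  have hs : Real.sin (x / 2) ^ 2 = 1 - Real.cos (x / 2) ^ 2 := by linarith
  rw [h2, hs] at hsq
  rw [hc, hch, h2]
  linear_combination (-2) * hsq

/-- The fourth power of `jπ + π/2` exceeds that of `α_j` by less than `(π/2)^4`. -/
theorem alpha_pow_pos {j : ℕ} (hj : 1 ≤ j) {a : ℝ}
    (ha : a ∈ Set.Ioo ((j : ℝ) * Real.pi) (((j : ℝ) + 1) * Real.pi))
    (hae : Real.tanh (a / 2) = (-1 : ℝ) ^ j * Real.tan (a / 2)) :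
    0 < a ^ 4 + (Real.pi / 2) ^ 4 - ((j : ℝ) * Real.pi + Real.pi / 2) ^ 4 := by
  have hpi := Real.pi_gt_d2
  have hpi' := Real.pi_lt_d2
  have hcc := (limitEq_of_tanh_eq ha hae).cos_mul_cosh
  have hch := Real.cosh_pos a
  have hcos : 0 < Real.cos a := pos_of_mul_pos_left (by rw [hcc]; exact one_pos) hch.le
  have hj0 : (1 : ℝ) ≤ j := by exact_mod_cast hj
  have hjpi : 0 < (j : ℝ) * Real.pi := by positivity
  have ha0 : 0 < a := hjpi.trans ha.1
  set A := (j : ℝ) * Real.pi + Real.pi / 2 with hA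
  have hsin : Real.sin (A - a) = (-1) ^ j * Real.cos a := by
    rw [show A - a = Real.pi / 2 - (a - j * Real.pi) by rw [hA]; ring, Real.sin_pi_div_two_sub,
      Real.cos_sub_nat_mul_pi]
  have hd1 : A - a < Real.pi / 2 := by linarith [ha.1]
  have hd2 : -(Real.pi / 2) < A - a := by linarith [ha.2]
  have hq : 0 < (Real.pi / 2) ^ 4 := by positivity
  have hle : a ≤ A → A ^ 4 < a ^ 4 + (Real.pi / 2) ^ 4 := by
    intro haA
    rcases Nat.even_or_odd j with he | ho
    · rw [he.neg_one_pow, one_mul] at hsin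
      have hj2 : (2 : ℝ) ≤ j := by
        obtain ⟨m, rfl⟩ := he
        exact_mod_cast (by omega : 2 ≤ m + m)
      have ha6 : 6 ≤ a := by nlinarith [ha.1]
      have hexp := Real.exp_pos a
      have hδ : (A - a) * Real.exp a ≤ Real.pi := by
        have h1 := Real.mul_le_sin (sub_nonneg.2 haA) hd1.le
        rw [hsin] at h1
        have h2 : Real.exp a ≤ 2 * Real.cosh a := by
          rw [Real.cosh_eq]; linarith [Real.exp_pos (-a)]
        have h3 : A - a ≤ Real.pi / 2 * Real.cos a := by
          calc A - a = Real.pi / 2 * (2 / Real.pi * (A - a)) := by field_simp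
            _ ≤ _ := by gcongr
        calc (A - a) * Real.exp a ≤ (Real.pi / 2 * Real.cos a) * (2 * Real.cosh a) := by gcongr
          _ = Real.pi * (Real.cos a * Real.cosh a) := by ring
          _ = Real.pi := by rw [hcc, mul_one]
      have hδ1 : A - a ≤ 0.1 := by
        have h6 : (2.7 : ℝ) ^ 6 ≤ Real.exp a := by
          refine le_trans ?_ (Real.exp_le_exp.2 ha6)
          rw [show (6 : ℝ) = ((6 : ℕ) : ℝ) * 1 by norm_num, Real.exp_nat_mul]
          have := Real.exp_one_gt_d9
          gcongr
          linarith
        nlinarith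
      have ha7 : 7 ≤ a := by nlinarith
      have hb := exp_bound ha7
      have hA3 : A ^ 3 ≤ (a + 0.1) ^ 3 := pow_le_pow_left₀ (by linarith) (by linarith) 3
      have h4 : A ^ 4 - a ^ 4 ≤ 4 * A ^ 3 * (A - a) := by
        have h := one_add_mul_le_pow (a := a / A - 1) (by
          have : 0 ≤ a / A := by positivity
          linarith) 4
        have hApos : 0 < A := by linarith
        have hA4 : 0 < A ^ 4 := by positivity
        have := mul_le_mul_of_nonneg_left h hA4.le
        rw [add_sub_cancel, div_pow, mul_div_cancel₀ _ hA4.ne'] at this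
        have e : A ^ 4 * (1 + ((4 : ℕ) : ℝ) * (a / A - 1)) = A ^ 4 + 4 * A ^ 3 * (a - A) := by
          push_cast
          field_simp
        rw [e] at this
        linarith
      have hpi3 : (3.14 : ℝ) ^ 3 ≤ Real.pi ^ 3 := by gcongr
      have h5 : 4 * A ^ 3 * (A - a) * Real.exp a < (Real.pi / 2) ^ 4 * Real.exp a := by
        have hApos : 0 < A ^ 3 := by
          have : 0 < A := by linarith
          positivity
        calc 4 * A ^ 3 * (A - a) * Real.exp a = 4 * A ^ 3 * ((A - a) * Real.exp a) := by ring
          _ ≤ 4 * A ^ 3 * Real.pi := by gcongr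
          _ ≤ Real.pi * (Real.pi ^ 3 / 16 * (2.1 * A ^ 3)) := by
            have : 4 ≤ Real.pi ^ 3 / 16 * 2.1 := by linarith
            nlinarith [mul_le_mul_of_nonneg_right this (mul_pos hApos Real.pi_pos).le]
          _ < Real.pi * (Real.pi ^ 3 / 16 * Real.exp a) := by gcongr; linarith
          _ = (Real.pi / 2) ^ 4 * Real.exp a := by ring
      have h6 := lt_of_mul_lt_mul_right h5 hexp.le
      linarith
    · rw [ho.neg_one_pow] at hsin
      have := Real.sin_nonneg_of_nonneg_of_le_pi (sub_nonneg.2 haA) (by linarith)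
      linarith
  rcases le_total a A with h | h
  · linarith [hle h]
  · have : A ^ 4 ≤ a ^ 4 := pow_le_pow_left₀ (by linarith) h 4
    linarith

theorem stmt16 (lam : ℕ → ℕ → ℝ)
    (hmono : ∀ n, 1 ≤ n → ∀ j k, 1 ≤ j → j < k → k ≤ n → lam n j < lam n k)
    (hspec : ∀ n, 1 ≤ n → ∀ j, 1 ≤ j → j ≤ n → lam n j ∈ spectrum ℝ (T n))
    (alpha : ℕ → ℝ)
    (halpha : ∀ j : ℕ, 1 ≤ j →
      alpha j ∈ Set.Ioo ((j : ℝ) * Real.pi) (((j : ℝ) + 1) * Real.pi) ∧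
      Real.tanh (alpha j / 2) = (-1 : ℝ) ^ j * Real.tan (alpha j / 2))
    (omega : ℕ → ℕ → ℝ)
    (homega : ∀ n j : ℕ, omega n j = lam n j - ∑ k ∈ Finset.range 4,
      dcoef k ((j : ℝ) * Real.pi / ((n : ℝ) + 2)) / ((n : ℝ) + 2) ^ k)
    (j : ℕ) (hj : 1 ≤ j) :
    Filter.Tendsto (fun n : ℕ => omega n j / lam n j) Filter.atTop
      (nhds (((alpha j) ^ 4 + (Real.pi / 2) ^ 4 - ((j : ℝ) * Real.pi + Real.pi / 2) ^ 4)
        / (alpha j) ^ 4)) ∧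
    ((alpha j) ^ 4 + (Real.pi / 2) ^ 4 - ((j : ℝ) * Real.pi + Real.pi / 2) ^ 4)
        / (alpha j) ^ 4 ≠ 0 ∧
    Filter.Tendsto (fun n : ℕ => omega n j / (lam n (j + 1) - lam n j)) Filter.atTop
      (nhds (((alpha j) ^ 4 + (Real.pi / 2) ^ 4 - ((j : ℝ) * Real.pi + Real.pi / 2) ^ 4)
        / ((alpha (j + 1)) ^ 4 - (alpha j) ^ 4))) ∧
    ((alpha j) ^ 4 + (Real.pi / 2) ^ 4 - ((j : ℝ) * Real.pi + Real.pi / 2) ^ 4)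
        / ((alpha (j + 1)) ^ 4 - (alpha j) ^ 4) ≠ 0 := by
  have hspos : 0 < (alpha j) ^ 4 + (Real.pi / 2) ^ 4
      - ((j : ℝ) * Real.pi + Real.pi / 2) ^ 4 := alpha_pow_pos hj (halpha j hj).1 (halpha j hj).2
  have ha0 : 0 < alpha j := lt_trans (by have := Real.pi_pos; positivity) (halpha j hj).1.1
  have hnext : alpha j < alpha (j + 1) := by
    have h := (halpha (j + 1) (by omega)).1.1
    push_cast at h
    exact (halpha j hj).1.2.trans h
  have hgap : 0 < (alpha (j + 1)) ^ 4 - (alpha j) ^ 4 :=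
    sub_pos.2 (pow_lt_pow_left₀ hnext ha0.le (by norm_num))
  have h1 := tendsto_eigenvalue lam hmono hspec hj (halpha j hj).1 (halpha j hj).2
  have h2 := tendsto_eigenvalue lam hmono hspec (Nat.le_add_left 1 j)
    (halpha (j + 1) (by omega)).1 (halpha (j + 1) (by omega)).2
  have hω : Tendsto (fun n : ℕ => ((n : ℝ) + 2) ^ 4 * omega n j) atTop
      (𝓝 ((alpha j) ^ 4 + (Real.pi / 2) ^ 4 - ((j : ℝ) * Real.pi + Real.pi / 2) ^ 4)) := by
    convert h1.sub (tendsto_expansion j hj) using 2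
    · rw [homega, mul_sub]
    · ring
  refine ⟨(hω.div h1 (by positivity)).congr fun n => ?_, by positivity,
    (hω.div (h2.sub h1) hgap.ne').congr fun n => ?_, by positivity⟩
  · exact mul_div_mul_left _ _ (by positivity)
  · simp only [Pi.div_apply]
    rw [← mul_sub]
    exact mul_div_mul_left _ _ (by positivity)
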